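/- Persistent Decentralized Coloring with uniformly random initial coloring and random vertex order converges to a proper (Δ+1)-coloring in O(n log Δ) expected recolorings; more precisely, the expected number of recolorings of each vertex v (beyond its initial random color) is at most H_{deg(v)} ≤ H_Δ, so the expected total is at most n·H_Δ. -/

import Mathlib

/-- Vertex `v` is conflicted under `χ`: some neighbor shares its color. -/
def Conflicted {V : Type*} {D : ℕ} (G : SimpleGraph V) (χ : V → Fin D) (v : V) : Prop :=
  ∃ u, G.Adj v u ∧ χ u = χ v

/-- Advance the processing position past unconflicted vertices: starting from position
`k` in the order `σ`, return the first position `≥ k` whose vertex is currently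
conflicted, or `n` if there is none. -/
noncomputable def advance {V : Type*} {D : ℕ} (G : SimpleGraph V) (n : ℕ)
    (σ : Fin n ≃ V) (χ : V → Fin D) (k : ℕ) : ℕ :=
  if h : k < n then
    letI : Decidable (Conflicted G χ (σ ⟨k, h⟩)) := Classical.propDecidable _
    if Conflicted G χ (σ ⟨k, h⟩) then k else advance G n σ χ (k + 1)
  else k
termination_by n - k
decreasing_by omega

/-- One recoloring step of Persistent Decentralized Coloring: advance to the currently
processed (conflicted) vertex and give it the (random) color `c`; if every remaining
vertex is unconflicted, do nothing.  The state is (current coloring, current position). -/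
noncomputable def pStep {V : Type*} {D : ℕ} (G : SimpleGraph V) (n : ℕ)
    (σ : Fin n ≃ V) (s : (V → Fin D) × ℕ) (c : Fin D) : (V → Fin D) × ℕ :=
  let k := advance G n σ s.1 s.2
  if h : k < n then
    letI : DecidableEq V := Classical.decEq V
    (Function.update s.1 (σ ⟨k, h⟩) c, k)
  else s

/-- The state of the process after consuming the list `l` of random colors. -/
noncomputable def pRun {V : Type*} {D : ℕ} (G : SimpleGraph V) (n : ℕ)
    (σ : Fin n ≃ V) (χ0 : V → Fin D) (l : List (Fin D)) : (V → Fin D) × ℕ :=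
  l.foldl (pStep G n σ) (χ0, 0)

/-- The (advanced) processing position after consuming `l`; it equals `n` iff the
process has terminated within `l`. -/
noncomputable def pPos {V : Type*} {D : ℕ} (G : SimpleGraph V) (n : ℕ)
    (σ : Fin n ≃ V) (χ0 : V → Fin D) (l : List (Fin D)) : ℕ :=
  advance G n σ (pRun G n σ χ0 l).1 (pRun G n σ χ0 l).2

/-- The expected total number of recolorings of Persistent Decentralized Coloring with
order `σ` and initial coloring `χ0`, expressed as `∑_{t≥0} P(more than t recolorings)`,
the probability being over the `t` uniformly random colors consumed so far. -/
noncomputable def expectedTotal {V : Type*} {D : ℕ} (G : SimpleGraph V) (n : ℕ)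
    (σ : Fin n ≃ V) (χ0 : V → Fin D) : ℝ :=
  ∑' t : ℕ, (Nat.card {f : Fin t → Fin D // pPos G n σ χ0 (List.ofFn f) ≠ n} : ℝ)
    / (D : ℝ) ^ t

/-- The expected number of recolorings performed by the vertex `v`, expressed as
`∑_{t≥0} P(the (t+1)-st random color is consumed by v)`. -/
noncomputable def expectedRecolors {V : Type*} {D : ℕ} (G : SimpleGraph V) (n : ℕ)
    (σ : Fin n ≃ V) (χ0 : V → Fin D) (v : V) : ℝ :=
  ∑' t : ℕ, (Nat.card {f : Fin t → Fin D //
      pPos G n σ χ0 (List.ofFn f) = (σ.symm v : ℕ)} : ℝ) / (D : ℝ) ^ t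

namespace PDC

section Proc
variable {V : Type*} {D : ℕ} (G : SimpleGraph V) (n : ℕ) (σ : Fin n ≃ V)

theorem advance_spec (χ : V → Fin D) (k : ℕ) :
    k ≤ advance G n σ χ k ∧ (k ≤ n → advance G n σ χ k ≤ n) ∧
    (∀ v, k ≤ (σ.symm v : ℕ) → (σ.symm v : ℕ) < advance G n σ χ k → ¬ Conflicted G χ v) ∧
    (∀ v, (σ.symm v : ℕ) = advance G n σ χ k → Conflicted G χ v) := by
  classical
  induction hm : n - k generalizing k with
  | zero =>
    have hk : ¬ k < n := by omega
    have : advance G n σ χ k = k := by rw [advance, dif_neg hk]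
    rw [this]
    refine ⟨le_refl _, fun h => h, fun v h1 h2 => by omega, fun v h => ?_⟩
    have := (σ.symm v).2
    omega
  | succ m ih =>
    have hk : k < n := by omega
    by_cases hc : Conflicted G χ (σ ⟨k, hk⟩)
    · have : advance G n σ χ k = k := by rw [advance, dif_pos hk, if_pos hc]
      rw [this]
      refine ⟨le_refl _, fun h => h, fun v h1 h2 => by omega, fun v h => ?_⟩
      have : v = σ ⟨k, hk⟩ := by
        rw [← Equiv.symm_apply_eq]; exact Fin.ext h
      rwa [this]
    · have : advance G n σ χ k = advance G n σ χ (k + 1) := by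
        rw [advance, dif_pos hk, if_neg hc]
      rw [this]
      obtain ⟨h1, h2, h3, h4⟩ := ih (k + 1) (by omega)
      refine ⟨by omega, fun h => h2 (by omega), fun v hv1 hv2 => ?_, h4⟩
      rcases Nat.eq_or_lt_of_le hv1 with h | h
      · have : v = σ ⟨k, hk⟩ := by
          rw [← Equiv.symm_apply_eq]; exact Fin.ext h.symm
        rwa [this]
      · exact h3 v h hv2

/-- Position of a state. -/
noncomputable def apos (s : (V → Fin D) × ℕ) : ℕ := advance G n σ s.1 s.2

theorem pStep_eq [DecidableEq V] (s : (V → Fin D) × ℕ) (c : Fin D) (u : V)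
    (hu : apos G n σ s = (σ.symm u : ℕ)) :
    pStep G n σ s c = (Function.update s.1 u c, (σ.symm u : ℕ)) := by
  unfold apos at hu
  have hlt : advance G n σ s.1 s.2 < n := by rw [hu]; exact (σ.symm u).2
  have hs : σ ⟨advance G n σ s.1 s.2, hlt⟩ = u := by
    rw [← Equiv.eq_symm_apply]; exact Fin.ext hu
  simp only [pStep]
  rw [dif_pos hlt]
  simp only [hs]
  rw [← hu]
  congr 2
  exact Subsingleton.elim _ _

theorem pStep_apos_ge (s : (V → Fin D) × ℕ) (c : Fin D) (hs : s.2 ≤ n) :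
    apos G n σ s ≤ apos G n σ (pStep G n σ s c) ∧ (pStep G n σ s c).2 ≤ n := by
  classical
  obtain ⟨h1, h2, -, -⟩ := advance_spec G n σ s.1 s.2
  by_cases hlt : apos G n σ s < n
  · have := pStep_eq G n σ s c (σ ⟨_, hlt⟩) (by simp)
    rw [this]
    constructor
    · have := (advance_spec G n σ (Function.update s.1 (σ ⟨_, hlt⟩) c)
        (σ.symm (σ ⟨_, hlt⟩) : ℕ)).1
      simpa [apos] using this
    · simp; exact hlt.le
  · have : pStep G n σ s c = s := by
      simp only [pStep]
      unfold apos at hlt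
      rw [dif_neg hlt]
    rw [this]; exact ⟨le_rfl, hs⟩

open Classical in
/-- Number of continuations of length `t` from `s` reaching position `p`. -/
noncomputable def N (p : ℕ) (t : ℕ) (s : (V → Fin D) × ℕ) : ℝ :=
  ∑ f : Fin t → Fin D, if apos G n σ ((List.ofFn f).foldl (pStep G n σ) s) = p then 1 else 0

theorem N_zero (p : ℕ) (s : (V → Fin D) × ℕ) [Decidable (apos G n σ s = p)] :
    N G n σ p 0 s = if apos G n σ s = p then 1 else 0 := by
  simp [N]

theorem N_succ (p t : ℕ) (s : (V → Fin D) × ℕ) :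
    N G n σ p (t + 1) s = ∑ c, N G n σ p t (pStep G n σ s c) := by
  classical
  simp only [N]
  rw [← Fintype.sum_prod_type']
  symm
  refine Fintype.sum_equiv (Fin.consEquiv (fun _ => Fin D)) _ _ ?_
  rintro ⟨c, f⟩
  simp [Fin.consEquiv, List.ofFn_succ]

/-- Expected number of visits at `p` in the first `T` steps. -/
noncomputable def W (p T : ℕ) (s : (V → Fin D) × ℕ) : ℝ :=
  ∑ t ∈ Finset.range T, N G n σ p t s / (D : ℝ) ^ t

theorem W_succ (p T : ℕ) (s : (V → Fin D) × ℕ) [Decidable (apos G n σ s = p)] :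
    W G n σ p (T + 1) s = (if apos G n σ s = p then 1 else 0) +
      (∑ c, W G n σ p T (pStep G n σ s c)) / D := by
  simp only [W]
  rw [Finset.sum_range_succ', N_zero, Finset.sum_comm, Finset.sum_div, add_comm]
  simp only [pow_zero, div_one]
  congr 1
  refine Finset.sum_congr rfl fun t _ => ?_
  rw [N_succ, ← Finset.sum_div, div_div, pow_succ]

theorem W_past (p T : ℕ) (s : (V → Fin D) × ℕ) (hs : s.2 ≤ n) (h : p < apos G n σ s) :
    W G n σ p T s = 0 := by
  classical
  induction T generalizing s with
  | zero => simp [W]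
  | succ T ih =>
    rw [W_succ, if_neg (by omega)]
    rw [Finset.sum_eq_zero]
    · simp
    · intro c _
      obtain ⟨h1, h2⟩ := pStep_apos_ge G n σ s c hs
      exact ih _ h2 (by omega)

variable [Fintype V] [DecidableEq V] [DecidableRel G.Adj]

/-- later neighbours -/
def later (v : V) : Finset V := (G.neighborFinset v).filter fun w => σ.symm v < σ.symm w

theorem W_at (v : V) (χ0 : V → Fin D) (m : ℕ) (hm0 : 0 < m)
    (hm : m + ((G.degree v - (later G n σ v).card) + ((later G n σ v).image χ0).card) ≤ D)
    (T : ℕ) (χ : V → Fin D) (k : ℕ) (hk : k ≤ n)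
    (hs : apos G n σ (χ, k) = (σ.symm v : ℕ))
    (hχ : ∀ w ∈ later G n σ v, χ w = χ0 w) :
    W G n σ (σ.symm v : ℕ) T (χ, k) ≤ (D : ℝ) / m := by
  classical
  have hD : 0 < D := by omega
  induction T generalizing χ k with
  | zero => simp [W]; positivity
  | succ T ih =>
    rw [W_succ, if_pos hs]
    set S := (G.neighborFinset v).image χ with hS
    have hScard : m + S.card ≤ D := by
      have h1 : S ⊆ (G.neighborFinset v \ later G n σ v).image χ ∪ (later G n σ v).image χ0 := by
        intro c hc
        simp only [hS, Finset.mem_image] at hc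
        obtain ⟨w, hw, rfl⟩ := hc
        by_cases hl : w ∈ later G n σ v
        · exact Finset.mem_union_right _ (by rw [hχ w hl]; exact Finset.mem_image_of_mem _ hl)
        · exact Finset.mem_union_left _
            (Finset.mem_image_of_mem _ (Finset.mem_sdiff.2 ⟨hw, hl⟩))
      have h2 := (Finset.card_le_card h1).trans (Finset.card_union_le _ _)
      have h3 : ((G.neighborFinset v \ later G n σ v).image χ).card ≤ _ := Finset.card_image_le
      have hsub : later G n σ v ⊆ G.neighborFinset v := Finset.filter_subset _ _
      rw [Finset.card_sdiff_of_subset hsub, SimpleGraph.card_neighborFinset_eq_degree] at h3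
      omega
    have key : ∀ c, W G n σ (σ.symm v : ℕ) T (pStep G n σ (χ, k) c) ≤
        if c ∈ S then (D : ℝ) / m else 0 := by
      intro c
      rw [pStep_eq G n σ _ c v hs]
      simp only
      have hv : (σ.symm v : ℕ) ≤ n := (σ.symm v).2.le
      obtain ⟨a1, a2, a3, a4⟩ := advance_spec G n σ (Function.update χ v c) (σ.symm v : ℕ)
      have hconf : Conflicted G (Function.update χ v c) v ↔ c ∈ S := by
        simp only [Conflicted, hS, Finset.mem_image, SimpleGraph.mem_neighborFinset,
          Function.update_self]
        constructor
        · rintro ⟨u, hu, h⟩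
          rw [Function.update_of_ne hu.ne'] at h
          exact ⟨u, hu, h⟩
        · rintro ⟨u, hu, h⟩
          refine ⟨u, hu, ?_⟩
          rw [Function.update_of_ne hu.ne', h]
      split_ifs with hc
      · refine ih _ _ hv ?_ ?_
        · by_contra hne
          exact a3 v le_rfl (lt_of_le_of_ne a1 (Ne.symm hne)) (hconf.2 hc)
        · intro w hw
          have : w ≠ v := by
            rintro rfl
            simp [later] at hw
          rw [Function.update_of_ne this, hχ w hw]
      · rw [W_past G n σ _ _ _ hv]
        refine lt_of_le_of_ne a1 fun h => hc (hconf.1 (a4 v h))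
    have hsum := Finset.sum_le_sum fun c (_ : c ∈ Finset.univ) => key c
    rw [← Finset.sum_filter, Finset.sum_const, nsmul_eq_mul] at hsum
    have hf : (Finset.univ.filter (· ∈ S)) = S := by ext; simp
    rw [hf] at hsum
    have hSc : (S.card : ℝ) ≤ D - m := by
      have : (m : ℝ) + S.card ≤ D := by exact_mod_cast hScard
      linarith
    have hm' : (0 : ℝ) < m := by exact_mod_cast hm0
    have hD' : (0 : ℝ) < D := by exact_mod_cast hD
    calc _ ≤ 1 + (((D : ℝ) - m) * (D / m)) / D := by
          gcongr
          refine hsum.trans ?_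
          gcongr
      _ = D / m := by field_simp; ring

/-- The bound for fixed initial coloring. -/
theorem W_main (v : V) (χ0 : V → Fin D) (m : ℕ) (hm0 : 0 < m)
    (hm : m + ((G.degree v - (later G n σ v).card) + ((later G n σ v).image χ0).card) ≤ D)
    (T : ℕ) (χ : V → Fin D) (k : ℕ) (hk : k ≤ n)
    (hχ : ∀ w, k < (σ.symm w : ℕ) → χ w = χ0 w) (hχv : χ v = χ0 v)
    (hP : ∀ u w, G.Adj u w → (σ.symm u : ℕ) < k → (σ.symm w : ℕ) ≠ k → χ u ≠ χ w)
    (hk0 : k < (σ.symm v : ℕ) ∨ k = 0) :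
    W G n σ (σ.symm v : ℕ) T (χ, k) ≤
      if χ0 v ∈ (later G n σ v).image χ0 then (D : ℝ) / m else 0 := by
  have hB : (0 : ℝ) ≤ if χ0 v ∈ (later G n σ v).image χ0 then (D : ℝ) / m else 0 := by
    split_ifs <;> positivity
  have hD : 0 < D := by omega
  induction T generalizing χ k with
  | zero => simpa [W] using hB
  | succ T ih =>
    obtain ⟨a1, a2, a3, a4⟩ := advance_spec G n σ χ k
    have hP' : ∀ u w, G.Adj u w → (σ.symm u : ℕ) < advance G n σ χ k →
        (σ.symm w : ℕ) ≠ advance G n σ χ k → χ u ≠ χ w := by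
      intro u w huw hu hw heq
      by_cases h1 : k ≤ (σ.symm u : ℕ)
      · exact a3 u h1 hu ⟨w, huw, heq.symm⟩
      · by_cases h2 : (σ.symm w : ℕ) = k
        · exact a3 w h2.ge (by omega) ⟨u, huw.symm, heq⟩
        · exact hP u w huw (by omega) h2 heq
    rcases lt_trichotomy (advance G n σ χ k) (σ.symm v : ℕ) with h | h | h
    · rw [W_succ, if_neg (by unfold apos; simp only; omega)]
      have hlt : advance G n σ χ k < n := h.trans (σ.symm v).2
      have hx : apos G n σ (χ, k) = (σ.symm (σ ⟨_, hlt⟩) : ℕ) := by simp [apos]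
      set x := σ ⟨_, hlt⟩ with hxdef
      have hx' : (σ.symm x : ℕ) = advance G n σ χ k := hx.symm
      have key : ∀ c, W G n σ (σ.symm v : ℕ) T (pStep G n σ (χ, k) c) ≤
          if χ0 v ∈ (later G n σ v).image χ0 then (D : ℝ) / m else 0 := by
        intro c
        rw [pStep_eq G n σ _ c x hx]
        simp only
        refine ih _ _ (by omega) ?_ ?_ ?_ (Or.inl (by omega))
        · intro w hw
          have : w ≠ x := by rintro rfl; omega
          rw [Function.update_of_ne this]
          exact hχ w (by omega)
        · have : v ≠ x := by intro hh; rw [hh] at h; omega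
          rw [Function.update_of_ne this, hχv]
        · intro u w huw hu hw
          have h1 : u ≠ x := by rintro rfl; omega
          have h2 : w ≠ x := by intro hh; exact hw (by rw [hh])
          rw [Function.update_of_ne h1, Function.update_of_ne h2]
          exact hP' u w huw (by omega) (by omega)
      have hsum := Finset.sum_le_sum fun c (_ : c ∈ Finset.univ) => key c
      rw [Finset.sum_const, nsmul_eq_mul, Finset.card_univ, Fintype.card_fin] at hsum
      have hD' : (0 : ℝ) < D := by exact_mod_cast hD
      rw [zero_add, div_le_iff₀ hD', mul_comm]
      rwa [mul_comm] at hsum ⊢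
    · have hconf := a4 v h.symm
      obtain ⟨u, huv, hu⟩ := hconf
      have hl : u ∈ later G n σ v := by
        have hne : (σ.symm u : ℕ) ≠ (σ.symm v : ℕ) := by
          intro hh
          exact huv.ne' (σ.symm.injective (Fin.ext hh))
        simp only [later, Finset.mem_filter, SimpleGraph.mem_neighborFinset]
        refine ⟨huv, Fin.lt_def.2 ?_⟩
        by_contra hlt
        by_cases h1 : k ≤ (σ.symm u : ℕ)
        · exact a3 u h1 (by omega) ⟨v, huv.symm, hu.symm⟩
        · exact hP u v huv.symm (by omega) (by omega) hu
      rw [if_pos]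
      · refine W_at G n σ v χ0 m hm0 hm _ _ _ hk h ?_
        intro w hw
        simp only [later, Finset.mem_filter, Fin.lt_def] at hw
        exact hχ w (by omega)
      · rw [← hχv, ← hu, hχ u]
        · exact Finset.mem_image_of_mem _ hl
        · simp only [later, Finset.mem_filter, Fin.lt_def] at hl
          omega
    · rw [W_past G n σ _ _ _ hk h]
      exact hB

theorem card_eq_N (χ0 : V → Fin D) (p t : ℕ) :
    (Nat.card {f : Fin t → Fin D // pPos G n σ χ0 (List.ofFn f) = p} : ℝ) =
      N G n σ p t (χ0, 0) := by
  classical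
  rw [Nat.card_eq_fintype_card, Fintype.card_subtype, Finset.card_filter]
  push_cast
  rfl

theorem N_nonneg (p t : ℕ) (s : (V → Fin D) × ℕ) : 0 ≤ N G n σ p t s := by
  unfold N
  exact Finset.sum_nonneg fun f _ => by split_ifs <;> norm_num

theorem expected_le (v : V) (χ0 : V → Fin D) (m : ℕ) (hm0 : 0 < m)
    (hm : m + ((G.degree v - (later G n σ v).card) + ((later G n σ v).image χ0).card) ≤ D) :
    Summable (fun t : ℕ => (Nat.card {f : Fin t → Fin D //
      pPos G n σ χ0 (List.ofFn f) = (σ.symm v : ℕ)} : ℝ) / (D : ℝ) ^ t) ∧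
    expectedRecolors G n σ χ0 v ≤
      if χ0 v ∈ (later G n σ v).image χ0 then (D : ℝ) / m else 0 := by
  have hnn : ∀ t : ℕ, 0 ≤ (Nat.card {f : Fin t → Fin D //
      pPos G n σ χ0 (List.ofFn f) = (σ.symm v : ℕ)} : ℝ) / (D : ℝ) ^ t := fun t => by positivity
  have hb : ∀ T : ℕ, ∑ t ∈ Finset.range T, (Nat.card {f : Fin t → Fin D //
      pPos G n σ χ0 (List.ofFn f) = (σ.symm v : ℕ)} : ℝ) / (D : ℝ) ^ t ≤
      if χ0 v ∈ (later G n σ v).image χ0 then (D : ℝ) / m else 0 := by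
    intro T
    simp only [card_eq_N]
    refine W_main G n σ v χ0 m hm0 hm T χ0 0 (Nat.zero_le _) (fun _ _ => rfl) rfl ?_ (Or.inr rfl)
    intro u w _ h
    omega
  exact ⟨summable_of_sum_range_le hnn hb, Real.tsum_le_of_sum_range_le hnn hb⟩

theorem total_eq (χ0 : V → Fin D)
    (hs : ∀ v, Summable (fun t : ℕ => (Nat.card {f : Fin t → Fin D //
      pPos G n σ χ0 (List.ofFn f) = (σ.symm v : ℕ)} : ℝ) / (D : ℝ) ^ t)) :
    expectedTotal G n σ χ0 = ∑ v, expectedRecolors G n σ χ0 v := by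
  classical
  unfold expectedTotal expectedRecolors
  rw [← Summable.tsum_finsetSum fun v _ => hs v]
  congr 1
  funext t
  rw [← Finset.sum_div]
  congr 1
  simp only [card_eq_N, N]
  rw [Finset.sum_comm, Nat.card_eq_fintype_card, Fintype.card_subtype, Finset.card_filter]
  push_cast
  refine Finset.sum_congr rfl fun f _ => ?_
  have hrun : ∀ (l : List (Fin D)) (s : (V → Fin D) × ℕ), s.2 ≤ n →
      (l.foldl (pStep G n σ) s).2 ≤ n := by
    intro l
    induction l with
    | nil => intro s h; exact h
    | cons c l ih => intro s h; exact ih _ (pStep_apos_ge G n σ s c h).2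
  have hle : pPos G n σ χ0 (List.ofFn f) ≤ n :=
    (advance_spec G n σ _ _).2.1 (hrun _ _ (Nat.zero_le _))
  have hpe : apos G n σ ((List.ofFn f).foldl (pStep G n σ) (χ0, 0)) =
    pPos G n σ χ0 (List.ofFn f) := rfl
  simp only [hpe]
  by_cases hn : pPos G n σ χ0 (List.ofFn f) = n
  · rw [if_neg (not_not.2 hn), Finset.sum_eq_zero]
    intro v _
    rw [if_neg]
    have := (σ.symm v).2
    omega
  · rw [if_pos hn, Finset.sum_eq_single (σ ⟨_, lt_of_le_of_ne hle hn⟩)]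
    · simp
    · intro v _ hv
      rw [if_neg]
      intro h
      apply hv
      rw [← Equiv.symm_apply_eq]
      exact Fin.ext h.symm
    · simp

end Proc

section Comb
variable {V : Type*} [Fintype V] [DecidableEq V]

theorem telescope {α : Type*} [LinearOrder α] (S : Finset V) (pos : V → α)
    (hinj : Function.Injective pos) (φ : Finset V → ℝ) :
    ∑ u ∈ S, (φ (S.filter fun w => pos u ≤ pos w) - φ (S.filter fun w => pos u < pos w)) =
      φ S - φ ∅ := by
  induction S using Finset.induction_on_min_value pos with
  | empty => simp
  | insert a s ha hmin ih =>
    rw [Finset.sum_insert ha]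
    have hlt : ∀ x ∈ s, pos a < pos x := fun x hx =>
      lt_of_le_of_ne (hmin x hx) fun h => ha (hinj h ▸ hx)
    have e1 : (insert a s).filter (fun w => pos a ≤ pos w) = insert a s :=
      Finset.filter_true_of_mem fun x hx => by
        rcases Finset.mem_insert.1 hx with rfl | hx
        · exact le_rfl
        · exact hmin x hx
    have e2 : (insert a s).filter (fun w => pos a < pos w) = s := by
      rw [Finset.filter_insert, if_neg (lt_irrefl _)]
      exact Finset.filter_true_of_mem hlt
    rw [e1, e2]
    have : ∀ u ∈ s, (φ ((insert a s).filter fun w => pos u ≤ pos w) -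
        φ ((insert a s).filter fun w => pos u < pos w)) =
        (φ (s.filter fun w => pos u ≤ pos w) - φ (s.filter fun w => pos u < pos w)) := by
      intro u hu
      rw [Finset.filter_insert, if_neg (not_le.2 (hlt u hu)), Finset.filter_insert,
        if_neg (not_lt.2 (hlt u hu).le)]
    rw [Finset.sum_congr rfl this, ih]
    ring

/-- Harmonic sum. -/
noncomputable def Hs (k : ℕ) : ℝ := ∑ i ∈ Finset.range k, 1 / ((i : ℝ) + 1)

/-- Potential. -/
noncomputable def pot {D : ℕ} (q : ℕ) (χ : V → Fin D) (L : Finset V) : ℝ :=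
  Hs (q + (L.card - (L.image χ).card))

theorem pot_insert {D : ℕ} (q : ℕ) (χ : V → Fin D) (L : Finset V) (v : V) (hv : v ∉ L) :
    pot q χ (insert v L) - pot q χ L =
      if χ v ∈ L.image χ then 1 / (((q + (L.card - (L.image χ).card) + 1 : ℕ)) : ℝ) else 0 := by
  have hle : (L.image χ).card ≤ L.card := Finset.card_image_le
  unfold pot
  rw [Finset.image_insert, Finset.card_insert_of_notMem hv]
  split_ifs with h
  · rw [Finset.insert_eq_of_mem h]
    have : q + (L.card + 1 - (L.image χ).card) = (q + (L.card - (L.image χ).card)) + 1 := by omega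
    rw [this, Hs, Finset.sum_range_succ, ← Hs]
    push_cast
    ring
  · rw [Finset.card_insert_of_notMem h]
    simp

/-- Summand attached to `u` in the set `S`. -/
noncomputable def F {D n : ℕ} (q : ℕ) (S : Finset V) (σ : Fin n ≃ V) (χ : V → Fin D) (u : V) : ℝ :=
  pot q χ (S.filter fun w => σ.symm u ≤ σ.symm w) - pot q χ (S.filter fun w => σ.symm u < σ.symm w)

theorem pot_map {D : ℕ} (q : ℕ) (χ : V → Fin D) (L : Finset V) (τ : Equiv.Perm V) :
    pot q (χ ∘ τ) L = pot q χ (L.image τ) := by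
  unfold pot
  rw [Finset.card_image_of_injective _ τ.injective, Finset.image_image]

theorem F_swap {D n : ℕ} (q : ℕ) (S : Finset V) (σ : Fin n ≃ V) (χ : V → Fin D) (u : V)
    (τ : Equiv.Perm V) (hτ : S.image τ = S) :
    F q S (σ.trans τ.symm) (χ ∘ τ) u = F q S σ χ (τ u) := by
  unfold F
  rw [pot_map, pot_map]
  have key : ∀ P : V → Prop, [DecidablePred P] →
      (S.filter (fun w => P (τ w))).image τ = S.filter P := by
    intro P _
    ext x
    constructor
    · intro hx
      obtain ⟨w, hw, rfl⟩ := Finset.mem_image.1 hx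
      rw [Finset.mem_filter] at hw ⊢
      exact ⟨hτ ▸ Finset.mem_image_of_mem _ hw.1, hw.2⟩
    · intro hx
      rw [Finset.mem_filter] at hx
      obtain ⟨hx1, hx2⟩ := hx
      rw [← hτ] at hx1
      obtain ⟨w, hw, rfl⟩ := Finset.mem_image.1 hx1
      exact Finset.mem_image_of_mem _ (Finset.mem_filter.2 ⟨hw, hx2⟩)
  rw [← key (fun w => σ.symm (τ u) ≤ σ.symm w), ← key (fun w => σ.symm (τ u) < σ.symm w)]
  rfl

theorem sum_F_eq {D n : ℕ} (q : ℕ) (S : Finset V) (u v : V) (hu : u ∈ S) (hv : v ∈ S) :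
    ∑ χ : V → Fin D, ∑ σ : Fin n ≃ V, F q S σ χ u = ∑ χ : V → Fin D, ∑ σ : Fin n ≃ V, F q S σ χ v := by
  set τ := Equiv.swap u v with hτdef
  have hτ : S.image τ = S := by
    apply Finset.eq_of_subset_of_card_le
    · intro x hx
      obtain ⟨w, hw, rfl⟩ := Finset.mem_image.1 hx
      rw [hτdef, Equiv.swap_apply_def]
      split_ifs <;> assumption
    · rw [Finset.card_image_of_injective _ τ.injective]
  symm
  refine Fintype.sum_equiv (Equiv.arrowCongr τ.symm (Equiv.refl _)) _ _ fun χ => ?_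
  refine Fintype.sum_equiv (Equiv.equivCongr (Equiv.refl _) τ.symm) _ _ fun σ => ?_
  have := F_swap q S σ χ u τ hτ
  rw [hτdef, Equiv.swap_apply_left] at this
  rw [← this]
  rfl

theorem sum_F_bound {D n : ℕ} (q : ℕ) (S : Finset V) (v : V) (hv : v ∈ S) :
    (S.card : ℝ) * ∑ χ : V → Fin D, ∑ σ : Fin n ≃ V, F q S σ χ v ≤
      ((Fintype.card (V → Fin D) : ℝ) * (Fintype.card (Fin n ≃ V) : ℝ)) *
        (Hs (q + (S.card - 1)) - Hs q) := by
  have h1 : (S.card : ℝ) * ∑ χ : V → Fin D, ∑ σ : Fin n ≃ V, F q S σ χ v =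
      ∑ u ∈ S, ∑ χ : V → Fin D, ∑ σ : Fin n ≃ V, F q S σ χ u := by
    rw [Finset.sum_congr rfl fun u hu => sum_F_eq q S u v hu hv, Finset.sum_const, nsmul_eq_mul]
  rw [h1, Finset.sum_comm]
  have h2 : ∀ χ : V → Fin D, ∑ u ∈ S, ∑ σ : Fin n ≃ V, F q S σ χ u ≤
      (Fintype.card (Fin n ≃ V) : ℝ) * (Hs (q + (S.card - 1)) - Hs q) := by
    intro χ
    rw [Finset.sum_comm]
    have : ∀ σ : Fin n ≃ V, ∑ u ∈ S, F q S σ χ u ≤ Hs (q + (S.card - 1)) - Hs q := by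
      intro σ
      unfold F
      rw [telescope S σ.symm σ.symm.injective (pot q χ)]
      have hpos : 0 < (S.image χ).card := Finset.card_pos.2 ⟨_, Finset.mem_image_of_mem χ hv⟩
      have e : pot q χ ∅ = Hs q := by simp [pot]
      rw [e]
      gcongr
      unfold pot Hs
      refine Finset.sum_le_sum_of_subset_of_nonneg ?_ fun i _ _ => by positivity
      intro i hi
      rw [Finset.mem_range] at hi ⊢
      omega
    calc _ ≤ ∑ σ : Fin n ≃ V, (Hs (q + (S.card - 1)) - Hs q) :=
          Finset.sum_le_sum fun σ _ => this σ
      _ = _ := by rw [Finset.sum_const, nsmul_eq_mul, Finset.card_univ]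
  calc _ ≤ ∑ χ : V → Fin D, (Fintype.card (Fin n ≃ V) : ℝ) * (Hs (q + (S.card - 1)) - Hs q) :=
        Finset.sum_le_sum fun χ _ => h2 χ
    _ = _ := by rw [Finset.sum_const, nsmul_eq_mul, Finset.card_univ]; ring

theorem Hs_final (q d : ℕ) :
    ((q + d + 1 : ℕ) : ℝ) * (Hs (q + d) - Hs q) ≤ ((d : ℝ) + 1) * Hs d := by
  unfold Hs
  rw [Finset.sum_range_add, add_sub_cancel_left, Finset.mul_sum, Finset.mul_sum]
  refine Finset.sum_le_sum fun j hj => ?_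
  rw [Finset.mem_range] at hj
  have hj' : (j : ℝ) + 1 ≤ d := by exact_mod_cast hj
  have hq : (0 : ℝ) ≤ q := by positivity
  rw [mul_one_div, mul_one_div, div_le_div_iff₀ (by positivity) (by positivity)]
  push_cast
  nlinarith

theorem Hs_eq (k : ℕ) : ∑ i ∈ Finset.Icc 1 k, (1 : ℝ) / (i : ℝ) = Hs k := by
  induction k with
  | zero => simp [Hs]
  | succ k ih => rw [Finset.sum_Icc_succ_top (by omega), ih, Hs, Hs, Finset.sum_range_succ]; simp

end Comb

theorem point_bound {V : Type*} [Fintype V] [DecidableEq V] (Δ n : ℕ) (G : SimpleGraph V)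
    [DecidableRel G.Adj] (hΔ : ∀ w, G.degree w ≤ Δ) (σ : Fin n ≃ V) (χ0 : V → Fin (Δ + 1)) (v : V) :
    Summable (fun t : ℕ => (Nat.card {f : Fin t → Fin (Δ + 1) //
      pPos G n σ χ0 (List.ofFn f) = (σ.symm v : ℕ)} : ℝ) / ((Δ + 1 : ℕ) : ℝ) ^ t) ∧
    expectedRecolors G n σ χ0 v ≤
      ((Δ + 1 : ℕ) : ℝ) * F (Δ - G.degree v) (insert v (G.neighborFinset v)) σ χ0 v := by
  set L := later G n σ v with hL
  have hvL : v ∉ L := by simp [hL, later]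
  have hLd : L.card ≤ G.degree v := by
    rw [← SimpleGraph.card_neighborFinset_eq_degree]
    exact Finset.card_le_card (Finset.filter_subset _ _)
  have hi : (L.image χ0).card ≤ L.card := Finset.card_image_le
  have hd := hΔ v
  obtain ⟨h1, h2⟩ := expected_le G n σ v χ0 (Δ - G.degree v + (L.card - (L.image χ0).card) + 1)
    (by omega) (by rw [← hL]; omega)
  refine ⟨h1, h2.trans_eq ?_⟩
  have e2 : (insert v (G.neighborFinset v)).filter (fun w => σ.symm v < σ.symm w) = L := by
    rw [Finset.filter_insert, if_neg (lt_irrefl _)]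
    rfl
  have e1 : (insert v (G.neighborFinset v)).filter (fun w => σ.symm v ≤ σ.symm w) =
      insert v L := by
    rw [Finset.filter_insert, if_pos le_rfl]
    congr 1
    refine Finset.filter_congr fun w hw => ?_
    rw [SimpleGraph.mem_neighborFinset] at hw
    constructor
    · intro h
      exact lt_of_le_of_ne h fun hh => hw.ne (σ.symm.injective hh)
    · exact le_of_lt
  unfold F
  rw [e1, e2, pot_insert _ _ _ _ hvL, mul_ite, mul_zero, mul_one_div]

theorem vertex_bound {V : Type*} [Fintype V] [DecidableEq V] (Δ n : ℕ) (G : SimpleGraph V)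
    [DecidableRel G.Adj] (hΔ : ∀ w, G.degree w ≤ Δ) (v : V) :
    (∑ χ0 : V → Fin (Δ + 1), ∑ σ : Fin n ≃ V, expectedRecolors G n σ χ0 v) ≤
      Hs (G.degree v) *
        ((Fintype.card (V → Fin (Δ + 1)) : ℝ) * (Fintype.card (Fin n ≃ V) : ℝ)) := by
  set C := ((Fintype.card (V → Fin (Δ + 1)) : ℝ) * (Fintype.card (Fin n ≃ V) : ℝ)) with hC
  have hC0 : 0 ≤ C := by positivity
  have h1 : (∑ χ0 : V → Fin (Δ + 1), ∑ σ : Fin n ≃ V, expectedRecolors G n σ χ0 v) ≤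
      ((Δ + 1 : ℕ) : ℝ) * ∑ χ0 : V → Fin (Δ + 1), ∑ σ : Fin n ≃ V,
        F (Δ - G.degree v) (insert v (G.neighborFinset v)) σ χ0 v := by
    rw [Finset.mul_sum]
    refine Finset.sum_le_sum fun χ _ => ?_
    rw [Finset.mul_sum]
    exact Finset.sum_le_sum fun σ _ => (point_bound Δ n G hΔ σ χ v).2
  have h2 := sum_F_bound (D := Δ + 1) (n := n) (Δ - G.degree v)
    (insert v (G.neighborFinset v)) v (Finset.mem_insert_self _ _)
  have hcard : (insert v (G.neighborFinset v)).card = G.degree v + 1 := by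
    rw [Finset.card_insert_of_notMem (by simp), SimpleGraph.card_neighborFinset_eq_degree]
  rw [hcard, Nat.add_sub_cancel, ← hC] at h2
  have h3 := Hs_final (Δ - G.degree v) (G.degree v)
  rw [Nat.sub_add_cancel (hΔ v)] at h2 h3
  set A := ∑ χ0 : V → Fin (Δ + 1), ∑ σ : Fin n ≃ V,
        F (Δ - G.degree v) (insert v (G.neighborFinset v)) σ χ0 v
  refine h1.trans ?_
  have hd : (0 : ℝ) < (G.degree v : ℝ) + 1 := by positivity
  push_cast at h2 h3 ⊢
  have hΔ0 : (0 : ℝ) ≤ (Δ : ℝ) + 1 := by positivity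
  have h4 := mul_le_mul_of_nonneg_left h2 hΔ0
  have h5 := mul_le_mul_of_nonneg_left h3 hC0
  refine le_of_mul_le_mul_left ?_ hd
  linarith

end PDC

/-- Persistent Decentralized Coloring with a uniformly random initial coloring and a
uniformly random processing order, on a graph of maximum degree `Δ` with `Δ+1` colors:
the expected number of recolorings of each vertex `v` (beyond its initial random color)
is at most `H_{deg v}`, and hence the expected total number of recolorings is at most
`n·H_Δ = O(n log Δ)`.  Expectations average over all initial colorings, all orders, and
the random resampling. -/
theorem stmt_16 {V : Type*} [Fintype V] [DecidableEq V] (Δ : ℕ) (G : SimpleGraph V)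
    [DecidableRel G.Adj] (hΔ : ∀ w, G.degree w ≤ Δ) :
    (∀ v : V,
      (∑ χ0 : V → Fin (Δ + 1), ∑ σ : Fin (Fintype.card V) ≃ V,
          expectedRecolors G (Fintype.card V) σ χ0 v)
        / ((Fintype.card (V → Fin (Δ + 1)) : ℝ) * (Fintype.card (Fin (Fintype.card V) ≃ V) : ℝ))
        ≤ ∑ i ∈ Finset.Icc 1 (G.degree v), (1 : ℝ) / (i : ℝ)) ∧
    (∑ χ0 : V → Fin (Δ + 1), ∑ σ : Fin (Fintype.card V) ≃ V,
        expectedTotal G (Fintype.card V) σ χ0)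
      / ((Fintype.card (V → Fin (Δ + 1)) : ℝ) * (Fintype.card (Fin (Fintype.card V) ≃ V) : ℝ))
      ≤ (Fintype.card V : ℝ) * ∑ i ∈ Finset.Icc 1 Δ, (1 : ℝ) / (i : ℝ) := by
  have hfirst := fun v => (PDC.vertex_bound Δ (Fintype.card V) G hΔ v)
  have hC : (0 : ℝ) < (Fintype.card (V → Fin (Δ + 1)) : ℝ) *
      (Fintype.card (Fin (Fintype.card V) ≃ V) : ℝ) := by
    have : 0 < Fintype.card (Fin (Fintype.card V) ≃ V) :=
      Fintype.card_pos_iff.2 ⟨(Fintype.equivFin V).symm⟩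
    have : 0 < Fintype.card (V → Fin (Δ + 1)) := Fintype.card_pos
    positivity
  simp only [PDC.Hs_eq]
  refine ⟨fun v => ?_, ?_⟩
  · rw [div_le_iff₀ hC]
    exact hfirst v
  · rw [div_le_iff₀ hC]
    have htot : ∀ (χ0 : V → Fin (Δ + 1)) (σ : Fin (Fintype.card V) ≃ V),
        expectedTotal G (Fintype.card V) σ χ0 =
          ∑ v, expectedRecolors G (Fintype.card V) σ χ0 v := fun χ0 σ =>
      PDC.total_eq G _ σ χ0 fun v => (PDC.point_bound Δ _ G hΔ σ χ0 v).1
    simp only [htot]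
    have hcomm : ∑ χ0 : V → Fin (Δ + 1), ∑ σ : Fin (Fintype.card V) ≃ V,
        ∑ v, expectedRecolors G (Fintype.card V) σ χ0 v =
        ∑ v, ∑ χ0 : V → Fin (Δ + 1), ∑ σ : Fin (Fintype.card V) ≃ V,
          expectedRecolors G (Fintype.card V) σ χ0 v := by
      symm
      rw [Finset.sum_comm]
      refine Finset.sum_congr rfl fun χ0 _ => ?_
      exact Finset.sum_comm
    rw [hcomm]
    have hmono : ∀ v, PDC.Hs (G.degree v) ≤ PDC.Hs Δ := by
      intro v
      unfold PDC.Hs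
      refine Finset.sum_le_sum_of_subset_of_nonneg ?_ fun i _ _ => by positivity
      exact Finset.range_subset_range.2 (hΔ v)
    calc _ ≤ ∑ _v : V, PDC.Hs Δ * ((Fintype.card (V → Fin (Δ + 1)) : ℝ) *
          (Fintype.card (Fin (Fintype.card V) ≃ V) : ℝ)) :=
          Finset.sum_le_sum fun v _ => (hfirst v).trans
            (mul_le_mul_of_nonneg_right (hmono v) hC.le)
      _ = _ := by
        rw [Finset.sum_const, nsmul_eq_mul, Finset.card_univ]
        ring
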